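/- For every real α with 0 ≤ α ≤ 1/2, every real ε > 0 and every deterministic delayed-decision algorithm with reservations for online Vertex Cover, there exists an instance (n, G) with τ(G) ≥ 1 whose cost with reservation cost α exceeds (1 + 2α − ε)·τ(G). In other words, for α ≤ 1/2 no such algorithm achieves a strict competitive ratio of 1 + 2α − ε. -/

import Mathlib

open SimpleGraph

/-- `S` is a vertex cover of `G`: it contains at least one endpoint of every edge. -/
def IsVC {n : ℕ} (G : SimpleGraph (Fin n)) (S : Finset (Fin n)) : Prop :=
  ∀ ⦃x y : Fin n⦄, G.Adj x y → x ∈ S ∨ y ∈ S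

/-- `vcNum G` is the minimum size of a vertex cover of `G`. -/
noncomputable def vcNum {n : ℕ} (G : SimpleGraph (Fin n)) : ℕ :=
  sInf {k : ℕ | ∃ S : Finset (Fin n), IsVC G S ∧ S.card = k}

/-- A deterministic delayed-decision algorithm with reservations for online
Vertex Cover: besides the irrevocably selected set `S`, the algorithm may reserve
a set `R` of vertices. -/
structure DelayedVCAlgorithmRes where
  /-- the set of irrevocably selected vertices after seeing the first `i` vertices -/
  S : ∀ n : ℕ, SimpleGraph (Fin n) → ℕ → Finset (Fin n)
  /-- the set of reserved vertices after seeing the first `i` vertices -/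
  R : ∀ n : ℕ, SimpleGraph (Fin n) → ℕ → Finset (Fin n)
  memS_lt : ∀ (n : ℕ) (G : SimpleGraph (Fin n)) (i : ℕ) (v : Fin n),
    v ∈ S n G i → (v : ℕ) < i
  memR_lt : ∀ (n : ℕ) (G : SimpleGraph (Fin n)) (i : ℕ) (v : Fin n),
    v ∈ R n G i → (v : ℕ) < i
  /-- determinism/online condition: on instances agreeing on their `i`-th prefix, the
  selected and reserved sets agree -/
  online : ∀ (n m : ℕ) (G : SimpleGraph (Fin n)) (G' : SimpleGraph (Fin m)) (i : ℕ)
      (hn : i ≤ n) (hm : i ≤ m),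
      (∀ x y : Fin i, G.Adj (Fin.castLE hn x) (Fin.castLE hn y) ↔
        G'.Adj (Fin.castLE hm x) (Fin.castLE hm y)) →
      (S n G i).image Fin.val = (S m G' i).image Fin.val ∧
      (R n G i).image Fin.val = (R m G' i).image Fin.val
  irrevocableS : ∀ (n : ℕ) (G : SimpleGraph (Fin n)) (i : ℕ), i < n →
    S n G i ⊆ S n G (i + 1)
  irrevocableR : ∀ (n : ℕ) (G : SimpleGraph (Fin n)) (i : ℕ), i < n →
    R n G i ⊆ R n G (i + 1)
  /-- the subgraph induced on the presented vertices outside `S ∪ R` has no edges -/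
  valid : ∀ (n : ℕ) (G : SimpleGraph (Fin n)) (i : ℕ), i ≤ n →
    ∀ x y : Fin n, (x : ℕ) < i → (y : ℕ) < i →
      x ∉ S n G i ∪ R n G i → y ∉ S n G i ∪ R n G i → ¬ G.Adj x y

/-- The cost of an algorithm with reservations on the instance `(n, G)` with
reservation cost `α`: the irrevocably selected vertices, plus the minimum number of
further vertices needed to complete them to a vertex cover, plus `α` per reserved
vertex. -/
noncomputable def resCost (A : DelayedVCAlgorithmRes) (α : ℝ) (n : ℕ)
    (G : SimpleGraph (Fin n)) : ℝ :=
  ((A.S n G n).card : ℝ) +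
    ((sInf {k : ℕ | ∃ T : Finset (Fin n), IsVC G (A.S n G n ∪ T) ∧ T.card = k} : ℕ) : ℝ) +
    α * ((A.R n G n).card : ℝ)

namespace DelayedVCAlgorithmRes

variable (A : DelayedVCAlgorithmRes)

/-- The vertices selected when the prefix of length `i` of the infinite graph `H` has arrived. -/
def sel (H : SimpleGraph ℕ) (i : ℕ) : Finset ℕ :=
  (A.S i (H.comap Fin.val) i).image Fin.val

/-- The vertices reserved when the prefix of length `i` of the infinite graph `H` has arrived. -/
def res (H : SimpleGraph ℕ) (i : ℕ) : Finset ℕ :=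
  (A.R i (H.comap Fin.val) i).image Fin.val

theorem image_eq_of_agree {H H' : SimpleGraph ℕ} {i n : ℕ} (hin : i ≤ n)
    (h : ∀ x < i, ∀ y < i, H.Adj x y ↔ H'.Adj x y) :
    (A.S n (H.comap Fin.val) i).image Fin.val = A.sel H' i ∧
      (A.R n (H.comap Fin.val) i).image Fin.val = A.res H' i :=
  A.online n i _ _ i hin le_rfl fun x y => h x x.2 y y.2

theorem sel_subset_range (H : SimpleGraph ℕ) (i : ℕ) : A.sel H i ⊆ Finset.range i := by
  intro x hx
  obtain ⟨v, -, rfl⟩ := Finset.mem_image.1 hx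
  exact Finset.mem_range.2 v.2

theorem S_subset {n : ℕ} (G : SimpleGraph (Fin n)) {i : ℕ} (hi : i ≤ n) :
    A.S n G i ⊆ A.S n G n :=
  Nat.decreasingInduction (fun j hj h => (A.irrevocableS n G j hj).trans h) subset_rfl hi

theorem R_subset {n : ℕ} (G : SimpleGraph (Fin n)) {i : ℕ} (hi : i ≤ n) :
    A.R n G i ⊆ A.R n G n :=
  Nat.decreasingInduction (fun j hj h => (A.irrevocableR n G j hj).trans h) subset_rfl hi

theorem sel_union_res_mono (H : SimpleGraph ℕ) {i n : ℕ} (h : i ≤ n) :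
    A.sel H i ∪ A.res H i ⊆ A.sel H n ∪ A.res H n := by
  obtain ⟨hS, hR⟩ := A.image_eq_of_agree (H := H) (H' := H) h fun _ _ _ _ => Iff.rfl
  rw [← hS, ← hR]
  exact Finset.union_subset_union (Finset.image_subset_image (A.S_subset _ h))
    (Finset.image_subset_image (A.R_subset _ h))

theorem sel_union_res_congr {H H' : SimpleGraph ℕ} {i : ℕ}
    (h : ∀ x < i, ∀ y < i, H.Adj x y ↔ H'.Adj x y) :
    A.sel H i ∪ A.res H i = A.sel H' i ∪ A.res H' i := by
  obtain ⟨hS, hR⟩ := A.image_eq_of_agree le_rfl h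
  rw [← hS, ← hR, sel, res]

theorem mem_or_mem_of_adj {H : SimpleGraph ℕ} {i x y : ℕ} (hx : x < i) (hy : y < i)
    (h : H.Adj x y) :
    x ∈ A.sel H i ∪ A.res H i ∨ y ∈ A.sel H i ∪ A.res H i := by
  have key : ∀ z (hz : z < i), z ∉ A.sel H i ∪ A.res H i →
      (⟨z, hz⟩ : Fin i) ∉ A.S i (H.comap Fin.val) i ∪ A.R i (H.comap Fin.val) i := by
    intro z hz hn hm
    apply hn
    rw [sel, res, ← Finset.image_union]
    exact Finset.mem_image_of_mem Fin.val hm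
  by_contra! hc
  exact A.valid i (H.comap Fin.val) i le_rfl ⟨x, hx⟩ ⟨y, hy⟩ hx hy
    (key x hx hc.1) (key y hy hc.2) h

end DelayedVCAlgorithmRes

/-- A vertex cover pays once for each pendant edge `{x, x + m}` with `x ∈ L`, and in addition for
each of its members below `m` outside `L`. -/
theorem card_add_card_sdiff_le_of_isVC {H : SimpleGraph ℕ} {m : ℕ} {L Q : Finset ℕ}
    {C : Finset (Fin (2 * m))} (hL : ∀ x ∈ L, x < m ∧ H.Adj x (x + m))
    (hC : IsVC (H.comap Fin.val) C) (hQ : Q ⊆ Finset.range m) (hQC : Q ⊆ C.image Fin.val) :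
    L.card + (Q \ L).card ≤ C.card := by
  classical
  set D := C.image Fin.val with hD
  have hcov : ∀ x ∈ L, x ∉ D → x + m ∈ D := by
    intro x hx hxD
    obtain ⟨hxm, hadj⟩ := hL x hx
    rcases hC (x := ⟨x, by omega⟩) (y := ⟨x + m, by omega⟩) hadj with h | h
    · exact absurd (Finset.mem_image_of_mem Fin.val h) hxD
    · exact Finset.mem_image_of_mem Fin.val h
  let f : ℕ → ℕ := fun x => if x ∈ D then x else x + m
  have hinj : Set.InjOn f L := by
    intro x hx y hy hxy
    have := (hL x hx).1
    have := (hL y hy).1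
    simp only [f] at hxy
    split_ifs at hxy <;> omega
  have hdisj : Disjoint (L.image f) (Q \ L) := by
    rw [Finset.disjoint_left]
    intro z hz hz'
    obtain ⟨x, hx, rfl⟩ := Finset.mem_image.1 hz
    obtain ⟨h1, h2⟩ := Finset.mem_sdiff.1 hz'
    have := Finset.mem_range.1 (hQ h1)
    simp only [f] at this h2
    split_ifs at this h2
    · exact h2 hx
    · omega
  calc L.card + (Q \ L).card = (L.image f ∪ (Q \ L)).card := by
        rw [Finset.card_union_of_disjoint hdisj, Finset.card_image_of_injOn hinj]
    _ ≤ D.card := by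
        refine Finset.card_le_card (Finset.union_subset ?_ (Finset.sdiff_subset.trans hQC))
        intro z hz
        obtain ⟨x, hx, rfl⟩ := Finset.mem_image.1 hz
        simp only [f]
        split_ifs with h
        · exact h
        · exact hcov x hx h
    _ = C.card := Finset.card_image_of_injective _ Fin.val_injective

theorem isVC_univ {n : ℕ} (G : SimpleGraph (Fin n)) : IsVC G Finset.univ :=
  fun _ _ _ => Or.inl (Finset.mem_univ _)

theorem vcNum_comap_eq_card {H : SimpleGraph ℕ} {m : ℕ} {L : Finset ℕ}
    (hL : ∀ x ∈ L, x < m ∧ H.Adj x (x + m)) (hcov : ∀ x y, H.Adj x y → x ∈ L ∨ y ∈ L) :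
    vcNum (H.comap (Fin.val : Fin (2 * m) → ℕ)) = L.card := by
  apply le_antisymm
  · refine Nat.sInf_le ⟨Finset.univ.filter (fun v : Fin (2 * m) => (v : ℕ) ∈ L), ?_, ?_⟩
    · intro x y hxy
      simpa using hcov x y hxy
    · rw [← Finset.card_image_of_injective _ Fin.val_injective]
      congr 1
      ext x
      simp only [Finset.mem_image, Finset.mem_filter, Finset.mem_univ, true_and]
      constructor
      · rintro ⟨v, hv, rfl⟩
        exact hv
      · intro hx
        have := (hL x hx).1
        exact ⟨⟨x, by omega⟩, hx, rfl⟩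
  · obtain ⟨C, hC, hcard⟩ := Nat.sInf_mem
      (s := {k : ℕ | ∃ S : Finset (Fin (2 * m)), IsVC (H.comap Fin.val) S ∧ S.card = k})
      ⟨_, Finset.univ, isVC_univ _, rfl⟩
    rw [vcNum, ← hcard]
    simpa using card_add_card_sdiff_le_of_isVC (Q := ∅) hL hC (by simp) (by simp)

theorem le_resCost_comap (A : DelayedVCAlgorithmRes) {α : ℝ} (hα : 0 ≤ α)
    {H H' : SimpleGraph ℕ} {m : ℕ} {L : Finset ℕ}
    (hagree : ∀ x < m, ∀ y < m, H.Adj x y ↔ H'.Adj x y)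
    (hL : ∀ x ∈ L, x < m ∧ H.Adj x (x + m)) :
    (L.card : ℝ) + (A.sel H' m \ L).card + α * (A.res H' m).card ≤
      resCost A α (2 * m) (H.comap Fin.val) := by
  set G : SimpleGraph (Fin (2 * m)) := H.comap Fin.val with hG
  have hm : m ≤ 2 * m := by omega
  obtain ⟨hS, hR⟩ := A.image_eq_of_agree hm hagree
  obtain ⟨T, hT, hcard⟩ := Nat.sInf_mem
    (s := {k : ℕ | ∃ T : Finset (Fin (2 * m)), IsVC G (A.S (2 * m) G (2 * m) ∪ T) ∧ T.card = k})
    ⟨_, Finset.univ, fun x _ _ => Or.inl (by simp), rfl⟩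
  have h1 : L.card + (A.sel H' m \ L).card ≤ (A.S (2 * m) G (2 * m)).card + T.card := by
    refine (card_add_card_sdiff_le_of_isVC hL hT (A.sel_subset_range H' m) ?_).trans
      (Finset.card_union_le _ _)
    rw [← hS]
    exact Finset.image_subset_image ((A.S_subset G hm).trans Finset.subset_union_left)
  have h2 : (A.res H' m).card ≤ (A.R (2 * m) G (2 * m)).card := by
    rw [← hR]
    exact Finset.card_image_le.trans (Finset.card_le_card (A.R_subset G hm))
  rw [resCost, ← hcard]
  have h1' : (L.card : ℝ) + (A.sel H' m \ L).card ≤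
      (A.S (2 * m) G (2 * m)).card + T.card := by exact_mod_cast h1
  have h2' : ((A.res H' m).card : ℝ) ≤ (A.R (2 * m) G (2 * m)).card := by exact_mod_cast h2
  have := mul_le_mul_of_nonneg_left h2' hα
  linarith

/-- The matching `{i, i + k}`, `i < k`, followed by vertices that are all joined to `V`. -/
def matchingJoin (k : ℕ) (V : Finset ℕ) : SimpleGraph ℕ :=
  SimpleGraph.fromRel fun x y => (y < 2 * k ∧ y = x + k) ∨ (2 * k ≤ y ∧ x ∈ V)

/-- The first `m` vertices of `matchingJoin k V`, followed by a pendant neighbour `x + m` for each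
vertex `x ∈ L`. -/
def matchingJoinPendant (k : ℕ) (V : Finset ℕ) (m : ℕ) (L : Finset ℕ) : SimpleGraph ℕ :=
  SimpleGraph.fromRel fun x y =>
    (y < 2 * k ∧ y = x + k) ∨ (2 * k ≤ y ∧ y < m ∧ x ∈ V) ∨ (y = x + m ∧ x ∈ L)

theorem matchingJoinPendant_agree (k : ℕ) (V : Finset ℕ) (m : ℕ) (L : Finset ℕ) :
    ∀ x < m, ∀ y < m, (matchingJoinPendant k V m L).Adj x y ↔ (matchingJoin k V).Adj x y := by
  intro x hx y hy
  simp only [matchingJoinPendant, matchingJoin, SimpleGraph.fromRel_adj]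
  grind

/-- The lower bound on the cost for `L = V` or `L` the complement of `V`. -/
theorem exists_instance_of_pendant (A : DelayedVCAlgorithmRes) {α : ℝ} (hα : 0 ≤ α)
    {k m : ℕ} {V L : Finset ℕ} (hm : 0 < m) (hL : L ⊆ Finset.range m) (hne : L.Nonempty)
    (hmatch : ∀ i < k, i ∈ L ∨ i + k ∈ L)
    (hjoin : ∀ x ∈ V, ∀ y, 2 * k ≤ y → y < m → x ∈ L ∨ y ∈ L) :
    ∃ (n : ℕ) (G : SimpleGraph (Fin n)), 1 ≤ vcNum G ∧ vcNum G = L.card ∧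
      (L.card : ℝ) + (A.sel (matchingJoin k V) m \ L).card +
        α * (A.res (matchingJoin k V) m).card ≤ resCost A α n G := by
  have hpend : ∀ x ∈ L, x < m ∧ (matchingJoinPendant k V m L).Adj x (x + m) := by
    intro x hx
    refine ⟨Finset.mem_range.1 (hL hx), ?_⟩
    rw [matchingJoinPendant, SimpleGraph.fromRel_adj]
    exact ⟨by omega, Or.inl (Or.inr (Or.inr ⟨rfl, hx⟩))⟩
  have hcov : ∀ x y, (matchingJoinPendant k V m L).Adj x y → x ∈ L ∨ y ∈ L := by
    intro x y hxy
    simp only [matchingJoinPendant, SimpleGraph.fromRel_adj] at hxy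
    rcases hxy with ⟨-, (⟨h, rfl⟩ | ⟨h, h', hV⟩ | ⟨-, h⟩) | (⟨h, rfl⟩ | ⟨h, h', hV⟩ | ⟨-, h⟩)⟩
    · exact hmatch x (by omega)
    · exact hjoin x hV y h h'
    · exact Or.inl h
    · exact (hmatch y (by omega)).symm
    · exact (hjoin y hV x h h').symm
    · exact Or.inr h
  have hvc := vcNum_comap_eq_card hpend hcov
  refine ⟨2 * m, _, ?_, hvc, le_resCost_comap A hα (matchingJoinPendant_agree k V m L) hpend⟩
  rw [hvc]
  exact hne.card_pos

/-- Choosing one endpoint of each edge of the matching such that all the other endpoints have been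
selected or reserved. -/
theorem exists_transversal (A : DelayedVCAlgorithmRes) (k : ℕ) :
    ∃ V ⊆ Finset.range (2 * k), V.card = k ∧ (∀ i < k, i ∈ V ↔ i + k ∉ V) ∧
      Finset.range (2 * k) \ V ⊆
        A.sel (matchingJoin k V) (2 * k) ∪ A.res (matchingJoin k V) (2 * k) := by
  classical
  set P := A.sel (matchingJoin k ∅) (2 * k) ∪ A.res (matchingJoin k ∅) (2 * k) with hP
  let f : ℕ → ℕ := fun i => if i ∈ P then i + k else i
  have hmem : ∀ x, x ∈ (Finset.range k).image f ↔ (x < k ∧ x ∉ P) ∨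
      (k ≤ x ∧ x < 2 * k ∧ x - k ∈ P) := by
    intro x
    simp only [Finset.mem_image, Finset.mem_range, f]
    constructor
    · rintro ⟨i, hi, rfl⟩
      split_ifs with h
      · right
        exact ⟨by omega, by omega, by simpa using h⟩
      · exact Or.inl ⟨hi, h⟩
    · rintro (⟨h, h'⟩ | ⟨h, h', hp⟩)
      · exact ⟨x, h, if_neg h'⟩
      · exact ⟨x - k, by omega, by rw [if_pos hp]; omega⟩
  refine ⟨(Finset.range k).image f, ?_, ?_, ?_, ?_⟩
  · intro x hx
    rw [hmem] at hx
    rw [Finset.mem_range]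
    omega
  · rw [Finset.card_image_of_injOn, Finset.card_range]
    intro x hx y hy hxy
    have hx := Finset.mem_range.1 hx
    have hy := Finset.mem_range.1 hy
    simp only [f] at hxy
    split_ifs at hxy <;> omega
  · intro i hi
    rw [hmem, hmem, Nat.add_sub_cancel]
    grind
  · have hagree : ∀ V : Finset ℕ, ∀ x < 2 * k, ∀ y < 2 * k,
        (matchingJoin k V).Adj x y ↔ (matchingJoin k ∅).Adj x y := by
      intro V x hx y hy
      simp only [matchingJoin, SimpleGraph.fromRel_adj, hx.not_ge, hy.not_ge, false_and, or_false]
    rw [A.sel_union_res_congr (hagree _), ← hP]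
    intro x hx
    rw [Finset.mem_sdiff, hmem, Finset.mem_range] at hx
    obtain ⟨hx, hxV⟩ := hx
    by_cases hxk : x < k
    · by_contra h
      exact hxV (Or.inl ⟨hxk, h⟩)
    · have hadj : (matchingJoin k ∅).Adj (x - k) x := by
        simp only [matchingJoin, SimpleGraph.fromRel_adj]
        exact ⟨by omega, Or.inl (Or.inl ⟨hx, by omega⟩)⟩
      refine (A.mem_or_mem_of_adj (i := 2 * k) (by omega) hx hadj).resolve_left fun h => ?_
      exact hxV (Or.inr ⟨by omega, hx, h⟩)

/-- For `α ≤ 1/2`, no deterministic delayed-decision algorithm with reservations for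
online Vertex Cover achieves a strict competitive ratio of `1 + 2α - ε`. -/
theorem vc_reservation_lower_bound_small_alpha (α ε : ℝ) (hα0 : 0 ≤ α)
    (hα : α ≤ 1 / 2) (hε : 0 < ε) (A : DelayedVCAlgorithmRes) :
    ∃ (n : ℕ) (G : SimpleGraph (Fin n)),
      1 ≤ vcNum G ∧ resCost A α n G > (1 + 2 * α - ε) * (vcNum G : ℝ) := by
  by_contra! hcon
  obtain ⟨k, hk⟩ := exists_nat_gt (1 / ε)
  have hεk : 1 < ε * k := by rwa [div_lt_iff₀' hε] at hk
  have hk0 : 0 < k := by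
    rcases Nat.eq_zero_or_pos k with rfl | h
    · norm_num at hεk
    · exact h
  obtain ⟨V, hVr, hVcard, hVk, hU⟩ := exists_transversal A k
  set H := matchingJoin k V with hH
  have costV : ∀ j, (k : ℝ) + (A.sel H (2 * k + j) \ V).card +
      α * (A.res H (2 * k + j)).card ≤ (1 + 2 * α - ε) * k := by
    intro j
    obtain ⟨n, G, h1, h2, h3⟩ := exists_instance_of_pendant A hα0 (k := k) (m := 2 * k + j)
      (V := V) (L := V) (by omega) (hVr.trans (Finset.range_mono (by omega)))
      (Finset.card_pos.1 (by omega)) (fun i hi => by have := hVk i hi; tauto)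
      (fun x hx _ _ _ => Or.inl hx)
    have := hcon n G h1
    rw [h2] at this
    rw [hVcard] at this h3
    exact h3.trans this
  have hUm : ∀ j, ∀ x < 2 * k, x ∉ V →
      x ∈ A.sel H (2 * k + j) ∪ A.res H (2 * k + j) := fun j x hx hxV =>
    A.sel_union_res_mono H (by omega) (hU (by simp [hx, hxV]))
  by_cases hw : ∃ j, 2 * k + j ∉ A.sel H (2 * k + (j + 1)) ∪ A.res H (2 * k + (j + 1)) ∧ j < k
  · classical
    let j := Nat.find hw
    obtain ⟨hj, hjk⟩ : 2 * k + j ∉ A.sel H (2 * k + (j + 1)) ∪ A.res H (2 * k + (j + 1)) ∧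
      j < k := Nat.find_spec hw
    have hjmin : ∀ l < j, 2 * k + l ∈ A.sel H (2 * k + (l + 1)) ∪ A.res H (2 * k + (l + 1)) := by
      intro l hl
      have := Nat.find_min hw hl
      by_contra h
      exact this ⟨h, by omega⟩
    clear_value j
    set m := 2 * k + (j + 1) with hm
    have hP : Finset.range (2 * k + j) ⊆ A.sel H m ∪ A.res H m := by
      intro x hx
      rw [Finset.mem_range] at hx
      by_cases hx2 : x < 2 * k
      · by_cases hxV : x ∈ V
        · refine (A.mem_or_mem_of_adj (i := m) (by omega) (by omega) ?_).resolve_right hj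
          simp only [hH, matchingJoin, SimpleGraph.fromRel_adj]
          exact ⟨by omega, Or.inl (Or.inr ⟨by omega, hxV⟩)⟩
        · exact hUm (j + 1) x hx2 hxV
      · have := hjmin (x - 2 * k) (by omega)
        rw [show 2 * k + (x - 2 * k) = x by omega] at this
        exact A.sel_union_res_mono H (by omega) this
    have hcard : 2 * k + j ≤ (A.sel H m).card + (A.res H m).card := by
      simpa using (Finset.card_le_card hP).trans (Finset.card_union_le _ _)
    have hVm : V ⊆ Finset.range m := hVr.trans (Finset.range_mono (by omega))
    have hLcard : (Finset.range m \ V).card = k + (j + 1) := by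
      rw [Finset.card_sdiff_of_subset hVm, Finset.card_range, hVcard]
      omega
    obtain ⟨n, G, h1, h2, h3⟩ := exists_instance_of_pendant A hα0 (k := k) (m := m)
      (V := V) (L := Finset.range m \ V) (by omega) Finset.sdiff_subset
      (Finset.card_pos.1 (by omega))
      (fun i hi => by
        have := hVk i hi
        simp only [Finset.mem_sdiff, Finset.mem_range]
        by_cases h : i ∈ V
        · exact Or.inr ⟨by omega, this.1 h⟩
        · exact Or.inl ⟨by omega, h⟩)
      (fun x _ y hy hym => by
        right
        rw [Finset.mem_sdiff, Finset.mem_range]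
        refine ⟨hym, fun h => ?_⟩
        have := Finset.mem_range.1 (hVr h)
        omega)
    have costU := h3.trans (hcon n G h1)
    rw [h2, hLcard] at costU
    have hsplit : (A.sel H m \ V).card + (A.sel H m \ (Finset.range m \ V)).card =
        (A.sel H m).card := by
      have : A.sel H m \ (Finset.range m \ V) = A.sel H m ∩ V := by
        ext x
        have hx : x ∈ A.sel H m → x ∈ Finset.range m := fun h => A.sel_subset_range H m h
        simp only [Finset.mem_sdiff, Finset.mem_inter]
        tauto
      rw [this, Finset.card_sdiff_add_card_inter]
    have cV := costV (j + 1)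
    rw [← hm] at cV
    rw [← hsplit] at hcard
    generalize (A.sel H m \ V).card = d at *
    generalize (A.sel H m \ (Finset.range m \ V)).card = b at *
    generalize (A.res H m).card = r at *
    have hcard' : (2 * k + j : ℝ) ≤ d + b + r := by exact_mod_cast hcard
    push_cast at costU
    have hr := mul_le_mul_of_nonneg_left hcard' hα0
    have hb : 0 ≤ (1 - 2 * α) * (b : ℝ) := mul_nonneg (by linarith) b.cast_nonneg
    have hd : 0 ≤ (1 - 2 * α) * (d : ℝ) := mul_nonneg (by linarith) d.cast_nonneg
    have hεj : 0 ≤ ε * (j : ℝ) := mul_nonneg hε.le j.cast_nonneg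
    nlinarith
  · push Not at hw
    have hP : Finset.range (3 * k) \ V ⊆ (A.sel H (2 * k + k) \ V) ∪ A.res H (2 * k + k) := by
      intro x hx
      rw [Finset.mem_sdiff, Finset.mem_range] at hx
      have : x ∈ A.sel H (2 * k + k) ∪ A.res H (2 * k + k) := by
        by_cases hx2 : x < 2 * k
        · exact hUm k x hx2 hx.2
        · by_contra h
          have := hw (x - 2 * k) fun h' => h ?_
          · omega
          · rw [show 2 * k + (x - 2 * k) = x by omega] at h'
            exact A.sel_union_res_mono H (by omega) h'
      simp only [Finset.mem_union, Finset.mem_sdiff] at this ⊢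
      tauto
    have hcard : 2 * k ≤ (A.sel H (2 * k + k) \ V).card + (A.res H (2 * k + k)).card := by
      have := (Finset.card_le_card hP).trans (Finset.card_union_le _ _)
      rw [Finset.card_sdiff_of_subset (hVr.trans (Finset.range_mono (by omega))),
        Finset.card_range, hVcard] at this
      omega
    have cV := costV k
    generalize (A.sel H (2 * k + k) \ V).card = d at *
    generalize (A.res H (2 * k + k)).card = r at *
    have hcard' : (2 * k : ℝ) ≤ d + r := by exact_mod_cast hcard
    have hr := mul_le_mul_of_nonneg_left hcard' hα0
    have hd : 0 ≤ (1 - α) * (d : ℝ) := mul_nonneg (by linarith) d.cast_nonneg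
    nlinarith
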